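/- arXiv:2401.14106 — 4 statements merged into one kernel-verified Lean document; each statement's English description precedes it below -/
import Mathlib

section
/- The Hatcher group G, i.e. the group presented by ⟨a, b | a^5 = b^3, b^3 = (a b)^2⟩, is perfect: its abelianization is trivial, equivalently its commutator subgroup is all of G. -/
open FreeGroup in
/-- The relators of the Hatcher group `⟨a, b | a^5 = b^3, b^3 = (a b)^2⟩`. -/
def hatcherRels : Set (FreeGroup (Fin 2)) :=
  {of 0 ^ 5 * (of 1 ^ 3)⁻¹, of 1 ^ 3 * ((of 0 * of 1) ^ 2)⁻¹}

/-- The Hatcher group `⟨a, b | a^5 = b^3, b^3 = (a b)^2⟩` is perfect: its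
commutator subgroup is the whole group. -/
theorem hatcherGroup_perfect : commutator (PresentedGroup hatcherRels) = ⊤ := by
  have key : ∀ x y : Abelianization (PresentedGroup hatcherRels),
      x ^ 5 = y ^ 3 → y ^ 3 = (x * y) ^ 2 → x = 1 ∧ y = 1 := by
    intro x y h1 h2
    have hy : y = x ^ 2 := by
      have h3 : y * y ^ 2 = x ^ 2 * y ^ 2 := by
        rw [← mul_pow, ← h2, ← pow_succ']
      exact mul_right_cancel h3
    subst hy
    have hx : x = 1 := by
      have h4 : x ^ 5 * x = x ^ 5 * 1 := by
        rw [mul_one, ← pow_succ]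
        rw [← pow_mul] at h1
        exact h1.symm
      exact mul_left_cancel h4
    subst hx
    simp
  have r1 : (PresentedGroup.of (rels := hatcherRels) 0) ^ 5 = PresentedGroup.of 1 ^ 3 := by
    have h := PresentedGroup.one_of_mem (rels := hatcherRels)
      (x := FreeGroup.of 0 ^ 5 * (FreeGroup.of 1 ^ 3)⁻¹) (by simp [hatcherRels])
    simp only [map_mul, map_inv, map_pow] at h
    exact mul_inv_eq_one.mp h
  have r2 : (PresentedGroup.of (rels := hatcherRels) 1) ^ 3
      = (PresentedGroup.of 0 * PresentedGroup.of 1) ^ 2 := by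
    have h := PresentedGroup.one_of_mem (rels := hatcherRels)
      (x := FreeGroup.of 1 ^ 3 * ((FreeGroup.of 0 * FreeGroup.of 1) ^ 2)⁻¹)
      (by simp [hatcherRels])
    simp only [map_mul, map_inv, map_pow] at h
    exact mul_inv_eq_one.mp h
  obtain ⟨h0, h1⟩ := key (Abelianization.of (PresentedGroup.of 0))
    (Abelianization.of (PresentedGroup.of 1))
    (by rw [← map_pow, ← map_pow, r1])
    (by rw [← map_mul, ← map_pow, ← map_pow, r2])
  have hf : (Abelianization.of : PresentedGroup hatcherRels →* _) = 1 := by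
    apply PresentedGroup.ext
    intro i
    fin_cases i
    · exact h0
    · exact h1
  rw [← Abelianization.ker_of, hf, MonoidHom.ker_one]
end

section
/- In the Higman group H, presented by four generators a, b, c, d subject to the relations d a d⁻¹ = a², a b a⁻¹ = b², b c b⁻¹ = c², c d c⁻¹ = d² (equivalently a = [d,a], b = [a,b], c = [b,c], d = [c,d]), each of the four generators has infinite order. -/
open FreeGroup in
/-- The relators of the Higman group
`⟨a, b, c, d | d a d⁻¹ = a², a b a⁻¹ = b², b c b⁻¹ = c², c d c⁻¹ = d²⟩`,
with `a, b, c, d` the generators `0, 1, 2, 3 : Fin 4`. -/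
def higmanRels : Set (FreeGroup (Fin 4)) :=
  {of 3 * of 0 * (of 3)⁻¹ * (of 0 ^ 2)⁻¹,
   of 0 * of 1 * (of 0)⁻¹ * (of 1 ^ 2)⁻¹,
   of 1 * of 2 * (of 1)⁻¹ * (of 2 ^ 2)⁻¹,
   of 2 * of 3 * (of 2)⁻¹ * (of 3 ^ 2)⁻¹}

namespace HigmanAux
open Monoid

def sP : Equiv.Perm ℚ := Equiv.mulLeft₀ 2 (by norm_num)
def tP : Equiv.Perm ℚ := Equiv.addLeft 1

lemma rel : sP * tP * sP⁻¹ = tP ^ 2 := by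
  rw [mul_inv_eq_iff_eq_mul]
  ext x
  simp [sP, tP, pow_two]
  ring

lemma s_zpow (n : ℤ) (x : ℚ) : (sP ^ n) x = 2 ^ n * x := by
  induction n using Int.induction_on generalizing x with
  | zero => simp
  | succ n ih => rw [zpow_add_one, Equiv.Perm.mul_apply, ih, zpow_add_one₀ (by norm_num)]; simp [sP]; ring
  | pred n ih =>
    have := ih (sP⁻¹ x)
    rw [zpow_sub_one, Equiv.Perm.mul_apply, this, zpow_sub_one₀ (by norm_num)]
    have h : sP⁻¹ x = 2⁻¹ * x := by
      rw [Equiv.Perm.inv_eq_iff_eq]; simp [sP]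
    rw [h]; ring

lemma t_zpow (n : ℤ) (x : ℚ) : (tP ^ n) x = n + x := by
  induction n using Int.induction_on generalizing x with
  | zero => simp
  | succ n ih => rw [zpow_add_one, Equiv.Perm.mul_apply, ih]; simp [tP]; ring
  | pred n ih =>
    have := ih (tP⁻¹ x)
    rw [zpow_sub_one, Equiv.Perm.mul_apply, this]
    have h : tP⁻¹ x = x - 1 := by
      rw [Equiv.Perm.inv_eq_iff_eq]; simp [tP]
    rw [h]; push_cast; ring

lemma t_inj (n : ℤ) (h : tP ^ n = 1) : n = 0 := by
  have := t_zpow n 0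
  rw [h] at this
  simpa using this.symm

lemma s_inj (n : ℤ) (h : sP ^ n = 1) : n = 0 := by
  have := s_zpow n 1
  rw [h] at this
  simp at this
  have h2 : (2:ℚ) ^ n = 2 ^ (0:ℤ) := by simpa using this.symm
  exact zpow_right_injective₀ (by norm_num) (by norm_num) h2

lemma st (n m : ℤ) (h : sP ^ n = tP ^ m) : n = 0 ∧ m = 0 := by
  have h1 := s_zpow n 0
  rw [h, t_zpow] at h1
  have hm : m = 0 := by simpa using h1
  subst hm
  exact ⟨s_inj n (by simpa using h), rfl⟩

/-- amalgamated element, in each factor -/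
def u (p i : Bool) : Equiv.Perm ℚ := if i = p then tP else sP
/-- free element, in each factor -/
def x (p i : Bool) : Equiv.Perm ℚ := if i = p then sP else tP

abbrev Z := Multiplicative ℤ

def phi (p i : Bool) : Z →* Equiv.Perm ℚ := zpowersHom _ (u p i)
def chi (p i : Bool) : Z →* Equiv.Perm ℚ := zpowersHom _ (x p i)

lemma phi_inj (p i : Bool) : Function.Injective (phi p i) := by
  rw [injective_iff_map_eq_one]
  intro n hn
  have : u p i ^ n.toAdd = 1 := hn
  have h0 : n.toAdd = 0 := by
    unfold u at this
    split_ifs at this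
    · exact t_inj _ this
    · exact s_inj _ this
  exact h0

lemma chi_mem (p i : Bool) (n : Z) (h : chi p i n ∈ (phi p i).range) : n = 1 := by
  obtain ⟨m, hm⟩ := h
  have : u p i ^ m.toAdd = x p i ^ n.toAdd := hm
  have h0 : n.toAdd = 0 := by
    unfold u x at this
    split_ifs at this
    · exact (st _ _ this.symm).1
    · exact (st _ _ this).2
  exact h0

abbrev F := CoprodI (fun _ : Bool => Z)
abbrev K (p : Bool) := PushoutI (phi p)

noncomputable def psi (p : Bool) : F →* K p :=
  CoprodI.lift (fun i => (PushoutI.of (φ := phi p) i).comp (chi p i))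

noncomputable def mapWord (p : Bool) (w : CoprodI.Word (fun _ : Bool => Z)) :
    CoprodI.Word (fun _ : Bool => Equiv.Perm ℚ) where
  toList := w.toList.map (fun l => ⟨l.1, chi p l.1 l.2⟩)
  ne_one := by
    intro l hl
    obtain ⟨k, hk, rfl⟩ := List.mem_map.1 hl
    intro h
    exact w.ne_one k hk (chi_mem p k.1 k.2 (by
      have h' : chi p k.1 k.2 = 1 := h
      rw [h']; exact one_mem _))
  chain_ne := by
    rw [List.isChain_map]
    exact w.chain_ne

lemma mapWord_prod (p : Bool) (w : CoprodI.Word (fun _ : Bool => Z)) :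
    PushoutI.ofCoprodI (φ := phi p) (mapWord p w).prod = psi p w.prod := by
  simp [CoprodI.Word.prod, mapWord, psi, map_list_prod, Function.comp_def]

lemma psi_inj (p : Bool) : Function.Injective (psi p) := by
  classical
  rw [injective_iff_map_eq_one]
  intro g hg
  obtain ⟨w, rfl⟩ := (CoprodI.Word.equiv (M := fun _ : Bool => Z)).symm.surjective g
  change psi p w.prod = 1 at hg
  change w.prod = 1
  rw [← mapWord_prod] at hg
  have hr : PushoutI.Reduced (phi p) (mapWord p w) := by
    intro l hl
    obtain ⟨k, hk, rfl⟩ := List.mem_map.1 hl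
    intro h
    exact w.ne_one k hk (chi_mem p k.1 k.2 h)
  have := hr.eq_empty_of_mem_range (phi_inj p) (by rw [hg]; exact one_mem _)
  have h2 : w.toList = [] := by
    have := congrArg CoprodI.Word.toList this
    simpa [mapWord, CoprodI.Word.empty] using this
  simp [CoprodI.Word.prod, h2]

abbrev L := PushoutI psi

noncomputable def fX (i : Bool) : Z →* L := 
  (PushoutI.base psi).comp (CoprodI.of (M := fun _ : Bool => Z) (i := i))
noncomputable def fU (p : Bool) : Z →* L :=
  (PushoutI.of (φ := psi) p).comp (PushoutI.base (phi p))

lemma fX_inj (i : Bool) : Function.Injective (fX i) :=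
  (PushoutI.base_injective psi_inj).comp (CoprodI.of_injective (M := fun _ : Bool => Z) i)
lemma fU_inj (p : Bool) : Function.Injective (fU p) :=
  (PushoutI.of_injective psi_inj p).comp (PushoutI.base_injective (phi_inj p))

noncomputable def g1 : Z := Multiplicative.ofAdd 1

lemma fX_eq (p i : Bool) :
    fX i g1 = PushoutI.of (φ := psi) p (PushoutI.of (φ := phi p) i (x p i)) := by
  simp only [fX, MonoidHom.comp_apply]
  rw [← PushoutI.of_apply_eq_base psi p]
  simp [psi, chi, g1]

lemma fU_eq (p i : Bool) :
    fU p g1 = PushoutI.of (φ := psi) p (PushoutI.of (φ := phi p) i (u p i)) := by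
  simp only [fU, MonoidHom.comp_apply]
  rw [← PushoutI.of_apply_eq_base (phi p) i]
  simp [phi, g1]

lemma rel1 (p : Bool) : fX p g1 * fU p g1 * (fX p g1)⁻¹ = fU p g1 ^ 2 := by
  rw [fX_eq p p, fU_eq p p]
  simp only [← map_mul, ← map_inv, ← map_pow]
  simp [u, x, rel]

lemma rel2 (p i : Bool) (h : i ≠ p) : fU p g1 * fX i g1 * (fU p g1)⁻¹ = fX i g1 ^ 2 := by
  rw [fX_eq p i, fU_eq p i]
  simp only [← map_mul, ← map_inv, ← map_pow]
  simp [u, x, h, rel]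

noncomputable def gens : Fin 4 → (Z →* L) := ![fX false, fU false, fX true, fU true]

lemma gens_inj (i : Fin 4) : Function.Injective (gens i) := by
  fin_cases i
  exacts [fX_inj false, fU_inj false, fX_inj true, fU_inj true]

lemma gens_rel : ∀ r ∈ higmanRels, FreeGroup.lift (fun i => gens i g1) r = 1 := by
  intro r hr
  simp only [higmanRels, Set.mem_insert_iff, Set.mem_singleton_iff] at hr
  rcases hr with rfl | rfl | rfl | rfl <;>
    simp only [map_mul, map_inv, map_pow, FreeGroup.lift_apply_of] <;>
    rw [mul_inv_eq_one]
  · exact rel2 true false (by decide)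
  · exact rel1 false
  · exact rel2 false true (by decide)
  · exact rel1 true

end HigmanAux

/-- In the Higman group, each of the four generators has infinite order:
if an integer power of a generator is trivial, then the exponent is zero. -/
theorem higmanGroup_generators_infinite_order :
    ∀ i : Fin 4, ∀ n : ℤ, (PresentedGroup.of i : PresentedGroup higmanRels) ^ n = 1 → n = 0 := by
  intro i n h
  have h2 := congrArg (PresentedGroup.toGroup HigmanAux.gens_rel) h
  rw [map_zpow, PresentedGroup.toGroup.of, map_one, ← map_zpow] at h2
  have h3 := (injective_iff_map_eq_one _).1 (HigmanAux.gens_inj i) _ h2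
  have h4 := congrArg Multiplicative.toAdd h3
  simpa [HigmanAux.g1] using h4
end

section
/- The Higman group H, presented by four generators a, b, c, d subject to the relations d a d⁻¹ = a², a b a⁻¹ = b², b c b⁻¹ = c², c d c⁻¹ = d², is nontrivial; indeed it is infinite. -/
open Monoid in
/-- If `L i` meets the amalgamated subgroup trivially for each `i`, then the free product of the
`L i` embeds in the amalgamated product. -/
theorem higman_lift_injective {ι : Type} {Z B : Type} [Group Z] [Group B]
    (φ L : ι → (Z →* B))
    (hφ : ∀ i, Function.Injective (φ i))
    (hL : ∀ i m n, L i m = φ i n → m = 1) :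
    Function.Injective (CoprodI.lift (M := fun _ : ι => Z)
      (fun i => (PushoutI.of (φ := φ) i).comp (L i))) := by
  classical
  rw [injective_iff_map_eq_one]
  intro x hx
  obtain ⟨w, rfl⟩ := (CoprodI.Word.equiv (M := fun _ : ι => Z)).symm.surjective x
  change CoprodI.lift _ w.prod = 1 at hx
  change w.prod = 1
  let w' : CoprodI.Word (fun _ : ι => B) :=
    { toList := w.toList.map (fun l => ⟨l.1, L l.1 l.2⟩)
      ne_one := by
        intro l hl
        obtain ⟨k, hk, rfl⟩ := List.mem_map.1 hl
        intro h
        exact w.ne_one k hk (hL k.1 k.2 1 (by simpa using h))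
      chain_ne := by
        rw [List.isChain_map]
        exact w.chain_ne }
  have hr : PushoutI.Reduced φ w' := by
    intro l hl
    obtain ⟨k, hk, rfl⟩ := List.mem_map.1 hl
    rintro ⟨n, hn⟩
    exact w.ne_one k hk (hL k.1 k.2 n hn.symm)
  have hp : PushoutI.ofCoprodI (φ := φ) w'.prod = 1 := by
    rw [← hx]
    simp [CoprodI.Word.prod, w', map_list_prod, Function.comp_def]
  have he := hr.eq_empty_of_mem_range hφ (by rw [hp]; exact one_mem _)
  have h0 : w.toList = [] := by
    have := congrArg CoprodI.Word.toList he
    simpa [w', CoprodI.Word.empty] using this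
  simp [CoprodI.Word.prod, h0]

theorem higman_BS : ∃ X Y : Equiv.Perm ℚ, X * Y * X⁻¹ = Y ^ 2 ∧
    ∀ m n : ℤ, X ^ m = Y ^ n → m = 0 ∧ n = 0 := by
  let u : ℚˣ := Units.mk0 2 two_ne_zero
  let X : Equiv.Perm ℚ := MulAction.toPermHom ℚˣ ℚ u
  let Y : Equiv.Perm ℚ := Equiv.addRight 1
  have hX : ∀ (m : ℤ) (q : ℚ), (X ^ m) q = 2 ^ m * q := by
    intro m q
    have h : X ^ m = MulAction.toPermHom ℚˣ ℚ (u ^ m) := (map_zpow _ _ _).symm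
    rw [h]
    simp [u, Units.smul_def]
  have hY : ∀ (m : ℤ) (q : ℚ), (Y ^ m) q = q + m := by
    intro m q
    simp [Y]
  refine ⟨X, Y, ?_, ?_⟩
  · ext q
    have h1 := hX 1
    have h2 := hX (-1)
    have h3 := hY 1
    have h4 := hY 2
    simp only [zpow_one, zpow_neg] at h1 h2 h3
    rw [← zpow_natCast, Equiv.Perm.mul_apply, Equiv.Perm.mul_apply, h2, h3, h1]
    simp only [Nat.cast_ofNat, h4]
    push_cast
    ring
  · intro m n h
    have h0 := congrArg (fun e : Equiv.Perm ℚ => e 0) h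
    have h1 := congrArg (fun e : Equiv.Perm ℚ => e 1) h
    simp only [hX, hY] at h0 h1
    have hn : n = 0 := by
      have : (n : ℚ) = 0 := by linarith
      exact_mod_cast this
    subst hn
    refine ⟨?_, rfl⟩
    have : (2 : ℚ) ^ m = 2 ^ (0 : ℤ) := by simpa using h1
    exact zpow_right_injective₀ (by norm_num) (by norm_num) this

open Monoid in
/-- A group with elements satisfying Higman's relations, the first of infinite order. -/
theorem higman_exists : ∃ (G : Type) (_ : Group G) (a b c d : G),
    d * a * d⁻¹ = a ^ 2 ∧ a * b * a⁻¹ = b ^ 2 ∧ b * c * b⁻¹ = c ^ 2 ∧ c * d * c⁻¹ = d ^ 2 ∧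
    Function.Injective (fun n : ℤ => a ^ n) := by
  obtain ⟨X, Y, hXY, hind⟩ := higman_BS
  let z : Multiplicative ℤ := Multiplicative.ofAdd 1
  let φ : Bool → (Multiplicative ℤ →* Equiv.Perm ℚ) := fun i => zpowersHom _ (if i then X else Y)
  let L : Bool → (Multiplicative ℤ →* Equiv.Perm ℚ) := fun i => zpowersHom _ (if i then Y else X)
  have hφ : ∀ i, Function.Injective (φ i) := by
    intro i
    rw [injective_iff_map_eq_one]
    intro m hm
    cases i
    · exact (hind 0 m.toAdd (by simpa [φ] using hm.symm)).2
    · exact (hind m.toAdd 0 (by simpa [φ] using hm)).1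
  have hL : ∀ i m n, L i m = φ i n → m = 1 := by
    intro i m n h
    cases i
    · exact (hind m.toAdd n.toAdd (by simpa [φ, L] using h)).1
    · exact (hind n.toAdd m.toAdd (by simpa [φ, L] using h.symm)).2
  let f : CoprodI (fun _ : Bool => Multiplicative ℤ) →* PushoutI φ := CoprodI.lift (fun i => (PushoutI.of (φ := φ) i).comp (L i))
  have hf : Function.Injective f := higman_lift_injective φ L hφ hL
  let s : CoprodI (fun _ : Bool => Multiplicative ℤ) →* CoprodI (fun _ : Bool => Multiplicative ℤ) := CoprodI.lift (fun i => CoprodI.of (M := fun _ : Bool => Multiplicative ℤ) (i := !i))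
  have hs : Function.Injective s := by
    have : s.comp s = MonoidHom.id _ := by
      apply CoprodI.ext_hom
      intro i
      ext
      cases i <;> simp [s]
    intro x y h
    have h2 := congrArg s h
    rw [← MonoidHom.comp_apply, ← MonoidHom.comp_apply, this] at h2
    exact h2
  let ψ : Bool → (CoprodI (fun _ : Bool => Multiplicative ℤ) →* PushoutI φ) := fun i => if i then f.comp s else f
  have hψ : ∀ i, Function.Injective (ψ i) := by
    intro i
    cases i
    · exact hf
    · exact hf.comp hs
  let e : (i : Bool) → CoprodI (fun _ : Bool => Multiplicative ℤ) := fun i => CoprodI.of (M := fun _ : Bool => Multiplicative ℤ) (i := i) z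
  let p : PushoutI φ := PushoutI.base φ z
  have hY : PushoutI.of (φ := φ) false Y = p := by
    have := PushoutI.of_apply_eq_base φ false z
    simpa [φ, z] using this
  have hX : PushoutI.of (φ := φ) true X = p := by
    have := PushoutI.of_apply_eq_base φ true z
    simpa [φ, z] using this
  have hf0 : f (e false) = PushoutI.of (φ := φ) false X := by
    simp [f, e, L, z]
  have hf1 : f (e true) = PushoutI.of (φ := φ) true Y := by
    simp [f, e, L, z]
  have hs0 : s (e false) = e true := by simp [s, e]
  have hs1 : s (e true) = e false := by simp [s, e]
  have r1 : f (e false) * p * (f (e false))⁻¹ = p ^ 2 := by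
    rw [hf0, ← hY, ← map_inv, ← map_mul, ← map_mul, hXY, map_pow]
  have r2 : p * f (e true) * p⁻¹ = f (e true) ^ 2 := by
    rw [hf1, ← hX, ← map_inv, ← map_mul, ← map_mul, hXY, map_pow]
  have b0 : ∀ x, PushoutI.base ψ x = PushoutI.of (φ := ψ) false (f x) := fun x =>
    (PushoutI.of_apply_eq_base ψ false x).symm
  have b1 : ∀ x, PushoutI.base ψ x = PushoutI.of (φ := ψ) true (f (s x)) := fun x =>
    (PushoutI.of_apply_eq_base ψ true x).symm
  refine ⟨PushoutI ψ, inferInstance, PushoutI.base ψ (e false), PushoutI.of (φ := ψ) false p,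
    PushoutI.base ψ (e true), PushoutI.of (φ := ψ) true p, ?_, ?_, ?_, ?_, ?_⟩
  · rw [b1, hs0, ← map_inv, ← map_mul, ← map_mul, r2, map_pow]
  · rw [b0, ← map_inv, ← map_mul, ← map_mul, r1, map_pow]
  · rw [b0, ← map_inv, ← map_mul, ← map_mul, r2, map_pow]
  · rw [b1, hs1, ← map_inv, ← map_mul, ← map_mul, r1, map_pow]
  · intro m n h
    have h2 : e false ^ m = e false ^ n := PushoutI.base_injective hψ
      ((map_zpow (PushoutI.base ψ) (e false) m).trans
        (Eq.trans h (map_zpow (PushoutI.base ψ) (e false) n).symm))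
    simp only [e, ← map_zpow] at h2
    have h3 := CoprodI.of_injective _ h2
    have h4 := congrArg Multiplicative.toAdd h3
    simpa [z] using h4

/-- The Higman group is nontrivial; indeed it is infinite. -/
theorem higmanGroup_nontrivial_and_infinite :
    Nontrivial (PresentedGroup higmanRels) ∧ Infinite (PresentedGroup higmanRels) := by
  have hinf : Infinite (PresentedGroup higmanRels) := by
    obtain ⟨G, _, a, b, c, d, h1, h2, h3, h4, hinj⟩ := higman_exists
    have hrel : ∀ r ∈ higmanRels, FreeGroup.lift ![a, b, c, d] r = 1 := by
      intro r hr
      simp only [higmanRels, Set.mem_insert_iff, Set.mem_singleton_iff] at hr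
      rcases hr with rfl | rfl | rfl | rfl <;>
        simp [h1, h2, h3, h4]
    refine Infinite.of_injective
      (fun n : ℤ => (PresentedGroup.of 0 : PresentedGroup higmanRels) ^ n) ?_
    intro m n h
    apply hinj
    have := congrArg (PresentedGroup.toGroup hrel) h
    simpa using this
  exact ⟨inferInstance, hinf⟩
end

section
/- Let X be a set with a distinguished basepoint pt. The map sending x : X to the class of the free-abelian-group generator of x in the quotient of the free abelian group on X by the subgroup generated by the generator of pt is injective. Equivalently: for x, y : X, if the difference of the generators at x and at y lies in the subgroup generated by the generator at pt, then x = y. -/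
/-- For a pointed set `(X, pt)`, the map sending `x : X` to the class of the
free-abelian-group generator at `x` in the quotient of `FreeAbelianGroup X` by
the subgroup generated by the generator at `pt` is injective.  (This is the
injectivity of the unit of the free–forgetful adjunction between abelian
groups and pointed sets.) -/
theorem freeAbelianGroup_pointed_unit_injective {X : Type*} (pt : X) :
    Function.Injective (fun x : X =>
      (QuotientAddGroup.mk (FreeAbelianGroup.of x) :
        FreeAbelianGroup X ⧸ AddSubgroup.closure {FreeAbelianGroup.of pt})) := by
  classical
  intro x y hxy
  have h := QuotientAddGroup.eq.mp hxy
  rw [AddSubgroup.mem_closure_singleton] at h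
  obtain ⟨n, hn⟩ := h
  have key : ∀ f : X → ℤ, f pt = 0 → f x = f y := by
    intro f hf
    have h2 := congrArg (FreeAbelianGroup.lift f) hn
    rw [map_zsmul, map_add, map_neg, FreeAbelianGroup.lift_apply_of,
      FreeAbelianGroup.lift_apply_of, FreeAbelianGroup.lift_apply_of, hf, smul_zero] at h2
    lia
  by_contra hne
  by_cases hx : x = pt
  · have h3 := key (fun z => if z = y then 1 else 0)
      (if_neg (fun h => hne (hx.trans h)))
    simp [hne] at h3
  · have h3 := key (fun z => if z = x then 1 else 0) (if_neg (fun h => hx h.symm))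
    simp [Ne.symm hne] at h3
end
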